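/- Let A be a Hermitian n×n matrix over the split quaternion algebra H, and suppose the i-th row of A is replaced with a left linear combination of other rows of A, i.e., the new i-th row is c_1·a_{i₁.} + ⋯ + c_k·a_{i_k.} with c_1,…,c_k ∈ H and indices i₁,…,i_k all different from i. Then for this modified matrix, rdet_i A_{i.}(c_1 a_{i₁.} + ⋯ + c_k a_{i_k.}) = 0 and cdet_i A_{i.}(c_1 a_{i₁.} + ⋯ + c_k a_{i_k.}) = 0. -/

import Mathlib

/-- The split quaternion (coquaternion) algebra over ℝ:
`i² = −1`, `j² = 1`, `k² = 1`, `ij = −ji = k`. -/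
abbrev SplitQuaternion : Type := QuaternionAlgebra ℝ (-1) 0 1

noncomputable section

namespace SplitQuaternion

variable {n : ℕ}

/-- The ordered product of entries of `A` along the cycle of `σ` containing `s`,
read in the "row" direction:
`a_{s, σ s} * a_{σ s, σ² s} * ⋯ * a_{σ^{L−1} s, s}` where `L` is the cycle length. -/
def rowCycleProd (A : Matrix (Fin n) (Fin n) SplitQuaternion) (σ : Equiv.Perm (Fin n))
    (s : Fin n) : SplitQuaternion :=
  ((List.range (Function.minimalPeriod σ s)).map
    (fun m => A ((σ ^ m) s) ((σ ^ (m + 1)) s))).prod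

/-- The ordered product of entries of `A` along the cycle of `σ` containing `s`,
read in the "column" direction:
`a_{s, σ^{L−1} s} * ⋯ * a_{σ² s, σ s} * a_{σ s, s}` where `L` is the cycle length. -/
def colCycleProd (A : Matrix (Fin n) (Fin n) SplitQuaternion) (σ : Equiv.Perm (Fin n))
    (s : Fin n) : SplitQuaternion :=
  (((List.range (Function.minimalPeriod σ s)).map
    (fun m => A ((σ ^ (m + 1)) s) ((σ ^ m) s))).reverse).prod

open scoped Classical in
/-- The least elements of the cycles of `σ` other than the cycle containing `i`,
listed in increasing order. -/
def otherCycleMins (σ : Equiv.Perm (Fin n)) (i : Fin n) : List (Fin n) :=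
  (Finset.univ.filter (fun s : Fin n =>
    (∀ t, σ.SameCycle s t → s ≤ t) ∧ ¬ σ.SameCycle i s)).sort (· ≤ ·)

/-- The `i`-th row determinant of `A`: the sum over all permutations `σ` of
`(−1)^{n−r}` (which is `sign σ`, `r` being the number of disjoint cycles of `σ`,
fixed points included) times the product of the entries of `A` ordered according to
the left-ordered cycle notation of `σ` whose first cycle starts with `i`, every
other cycle starting with its least element, the cycles being ordered by
increasing least elements. -/
def rdet (A : Matrix (Fin n) (Fin n) SplitQuaternion) (i : Fin n) : SplitQuaternion :=
  ∑ σ : Equiv.Perm (Fin n),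
    ((Equiv.Perm.sign σ : ℤ) : SplitQuaternion) *
      (rowCycleProd A σ i * ((otherCycleMins σ i).map (rowCycleProd A σ)).prod)

/-- The `j`-th column determinant of `A`: the sum over all permutations `τ` of
`(−1)^{n−r}` times the product of the entries of `A` ordered according to the
right-ordered cycle notation of `τ` whose rightmost cycle ends with `j`, every
other cycle ending with its least element, the cycles being ordered (from right
to left) by increasing least elements. -/
def cdet (A : Matrix (Fin n) (Fin n) SplitQuaternion) (j : Fin n) : SplitQuaternion :=
  ∑ σ : Equiv.Perm (Fin n),
    ((Equiv.Perm.sign σ : ℤ) : SplitQuaternion) *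
      ((((otherCycleMins σ j).reverse).map (colCycleProd A σ)).prod * colCycleProd A σ j)

/-- The determinant of a Hermitian matrix: the common value of all row and column
determinants (here given as `rdet` at the index `0`). -/
def hdet [NeZero n] (A : Matrix (Fin n) (Fin n) SplitQuaternion) : SplitQuaternion :=
  rdet A 0


/-! ### Reversing a single cycle of a permutation -/

/-- The permutation obtained from `σ` by inverting the cycle containing `s`. -/
def reverseCycle (σ : Equiv.Perm (Fin n)) (s : Fin n) : Equiv.Perm (Fin n) :=
  σ * ((σ.cycleOf s)⁻¹ * (σ.cycleOf s)⁻¹)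

lemma reverseCycle_apply_of_sameCycle {σ : Equiv.Perm (Fin n)} {s t : Fin n}
    (h : σ.SameCycle s t) : reverseCycle σ s t = σ⁻¹ t := by
  have h1 : (σ⁻¹).SameCycle s t := Equiv.Perm.sameCycle_inv.2 h
  have h2 : (σ⁻¹).SameCycle s (σ⁻¹ t) := Equiv.Perm.sameCycle_apply_right.2 h1
  simp only [reverseCycle, Equiv.Perm.mul_apply, Equiv.Perm.cycleOf_inv]
  rw [h1.cycleOf_apply, h2.cycleOf_apply]
  simp

lemma reverseCycle_apply_of_not_sameCycle {σ : Equiv.Perm (Fin n)} {s t : Fin n}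
    (h : ¬ σ.SameCycle s t) : reverseCycle σ s t = σ t := by
  have h1 : ¬ (σ⁻¹).SameCycle s t := fun h' => h (Equiv.Perm.sameCycle_inv.1 h')
  simp only [reverseCycle, Equiv.Perm.mul_apply, Equiv.Perm.cycleOf_inv]
  rw [Equiv.Perm.cycleOf_apply_of_not_sameCycle h1, Equiv.Perm.cycleOf_apply_of_not_sameCycle h1]

lemma reverseCycle_pow_apply_of_sameCycle {σ : Equiv.Perm (Fin n)} {s t : Fin n}
    (h : σ.SameCycle s t) (m : ℕ) : (reverseCycle σ s ^ m) t = (σ⁻¹ ^ m) t := by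
  induction m with
  | zero => rfl
  | succ m ih =>
    rw [pow_succ', pow_succ', Equiv.Perm.mul_apply, Equiv.Perm.mul_apply, ih]
    exact reverseCycle_apply_of_sameCycle (Equiv.Perm.sameCycle_inv.1
      (Equiv.Perm.sameCycle_pow_right.2 (Equiv.Perm.sameCycle_inv.2 h)))

lemma reverseCycle_pow_apply_of_not_sameCycle {σ : Equiv.Perm (Fin n)} {s t : Fin n}
    (h : ¬ σ.SameCycle s t) (m : ℕ) : (reverseCycle σ s ^ m) t = (σ ^ m) t := by
  induction m with
  | zero => rfl
  | succ m ih =>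
    rw [pow_succ', pow_succ', Equiv.Perm.mul_apply, Equiv.Perm.mul_apply, ih]
    exact reverseCycle_apply_of_not_sameCycle fun h' => h (Equiv.Perm.sameCycle_pow_right.1 h')

lemma sameCycle_reverseCycle {σ : Equiv.Perm (Fin n)} {s a b : Fin n} :
    (reverseCycle σ s).SameCycle a b ↔ σ.SameCycle a b := by
  by_cases h : σ.SameCycle s a
  · rw [← Equiv.Perm.sameCycle_inv (f := σ)]
    constructor <;> intro h'
    · obtain ⟨m, rfl⟩ := h'.exists_nat_pow_eq
      rw [reverseCycle_pow_apply_of_sameCycle h]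
      exact Equiv.Perm.sameCycle_pow_right.2 (.refl _ _)
    · obtain ⟨m, rfl⟩ := h'.exists_nat_pow_eq
      rw [← reverseCycle_pow_apply_of_sameCycle h]
      exact Equiv.Perm.sameCycle_pow_right.2 (.refl _ _)
  · constructor <;> intro h'
    · obtain ⟨m, rfl⟩ := h'.exists_nat_pow_eq
      rw [reverseCycle_pow_apply_of_not_sameCycle h]
      exact Equiv.Perm.sameCycle_pow_right.2 (.refl _ _)
    · obtain ⟨m, rfl⟩ := h'.exists_nat_pow_eq
      rw [← reverseCycle_pow_apply_of_not_sameCycle h]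
      exact Equiv.Perm.sameCycle_pow_right.2 (.refl _ _)

lemma reverseCycle_reverseCycle (σ : Equiv.Perm (Fin n)) (s : Fin n) :
    reverseCycle (reverseCycle σ s) s = σ := by
  ext1 t
  by_cases h : σ.SameCycle s t
  · rw [reverseCycle_apply_of_sameCycle (sameCycle_reverseCycle.2 h), Equiv.Perm.inv_eq_iff_eq,
      reverseCycle_apply_of_sameCycle (Equiv.Perm.sameCycle_apply_right.2 h)]
    simp
  · rw [reverseCycle_apply_of_not_sameCycle (fun h' => h (sameCycle_reverseCycle.1 h')),
      reverseCycle_apply_of_not_sameCycle h]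

lemma sign_reverseCycle (σ : Equiv.Perm (Fin n)) (s : Fin n) :
    Equiv.Perm.sign (reverseCycle σ s) = Equiv.Perm.sign σ := by
  simp [reverseCycle]

/-! ### Products along a cycle -/

lemma minimalPeriod_congr {σ τ : Equiv.Perm (Fin n)} {s : Fin n}
    (h : ∀ m : ℕ, (σ ^ m) s = (τ ^ m) s) :
    Function.minimalPeriod σ s = Function.minimalPeriod τ s := by
  rw [Function.minimalPeriod_eq_minimalPeriod_iff]
  intro m
  simp only [Function.IsPeriodicPt, Function.IsFixedPt, Equiv.Perm.iterate_eq_pow, h]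

lemma rowCycleProd_congr {A B : Matrix (Fin n) (Fin n) SplitQuaternion}
    {σ τ : Equiv.Perm (Fin n)} {s : Fin n} (h : ∀ m : ℕ, (σ ^ m) s = (τ ^ m) s)
    (hAB : ∀ t, σ.SameCycle s t → A t = B t) :
    rowCycleProd A σ s = rowCycleProd B τ s := by
  simp only [rowCycleProd, minimalPeriod_congr h]
  congr 1
  refine List.map_congr_left fun m _ => ?_
  rw [hAB _ (Equiv.Perm.sameCycle_pow_right.2 (.refl _ _)), h, h]

lemma colCycleProd_congr {A B : Matrix (Fin n) (Fin n) SplitQuaternion}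
    {σ τ : Equiv.Perm (Fin n)} {s : Fin n} (h : ∀ m : ℕ, (σ ^ m) s = (τ ^ m) s)
    (hAB : ∀ t, σ.SameCycle s t → A t = B t) :
    colCycleProd A σ s = colCycleProd B τ s := by
  simp only [colCycleProd, minimalPeriod_congr h]
  congr 2
  refine List.map_congr_left fun m _ => ?_
  rw [hAB _ (Equiv.Perm.sameCycle_pow_right.2 (.refl _ _)), h, h]

lemma pow_minimalPeriod_apply (σ : Equiv.Perm (Fin n)) (s : Fin n) :
    (σ ^ Function.minimalPeriod σ s) s = s := by
  rw [← Equiv.Perm.iterate_eq_pow]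
  exact Function.iterate_minimalPeriod

lemma minimalPeriod_inv (σ : Equiv.Perm (Fin n)) (s : Fin n) :
    Function.minimalPeriod (σ⁻¹ : Equiv.Perm (Fin n)) s = Function.minimalPeriod σ s := by
  rw [Function.minimalPeriod_eq_minimalPeriod_iff]
  intro m
  simp only [Function.IsPeriodicPt, Function.IsFixedPt, Equiv.Perm.iterate_eq_pow, inv_pow,
    Equiv.Perm.inv_eq_iff_eq]
  exact eq_comm

lemma minimalPeriod_pos (σ : Equiv.Perm (Fin n)) (s : Fin n) :
    0 < Function.minimalPeriod σ s :=
  Function.minimalPeriod_pos_of_mem_periodicPts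
    (Function.Injective.mem_periodicPts σ.injective s)

lemma colCycleProd_inv (A : Matrix (Fin n) (Fin n) SplitQuaternion) (σ : Equiv.Perm (Fin n))
    (s : Fin n) : colCycleProd A σ⁻¹ s = rowCycleProd A σ s := by
  have key : ∀ m ≤ Function.minimalPeriod σ s,
      ((σ⁻¹) ^ (Function.minimalPeriod σ s - m)) s = (σ ^ m) s := by
    intro m hm
    rw [inv_pow, Equiv.Perm.inv_eq_iff_eq, ← Equiv.Perm.mul_apply, ← pow_add,
      Nat.sub_add_cancel hm, pow_minimalPeriod_apply]
  rw [colCycleProd, rowCycleProd, minimalPeriod_inv]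
  congr 1
  apply List.ext_getElem (by simp)
  intro m h1 h2
  have hm : m < Function.minimalPeriod σ s := by simpa using h2
  simp only [List.getElem_reverse, List.getElem_map, List.getElem_range, List.length_map,
    List.length_range]
  rw [← key m hm.le, ← key (m + 1) hm]
  congr 3 <;> omega

lemma star_prod_reverse (l : List SplitQuaternion) : star l.reverse.prod = (l.map star).prod := by
  induction l with
  | nil => simp
  | cons a l ih => simp [ih]

lemma star_colCycleProd {A : Matrix (Fin n) (Fin n) SplitQuaternion} (hA : A.IsHermitian)
    (σ : Equiv.Perm (Fin n)) (s : Fin n) :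
    star (colCycleProd A σ s) = rowCycleProd A σ s := by
  rw [colCycleProd, rowCycleProd, star_prod_reverse, List.map_map]
  congr 1
  exact List.map_congr_left fun m _ => hA.apply _ _

lemma rowCycleProd_inv {A : Matrix (Fin n) (Fin n) SplitQuaternion} (hA : A.IsHermitian)
    (σ : Equiv.Perm (Fin n)) (s : Fin n) :
    rowCycleProd A σ⁻¹ s = star (rowCycleProd A σ s) := by
  rw [← star_colCycleProd hA, colCycleProd_inv]

lemma rowCycleProd_reverseCycle_of_sameCycle {A : Matrix (Fin n) (Fin n) SplitQuaternion}
    (hA : A.IsHermitian) {σ : Equiv.Perm (Fin n)} {s t : Fin n} (h : σ.SameCycle s t) :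
    rowCycleProd A (reverseCycle σ s) t = star (rowCycleProd A σ t) := by
  rw [← rowCycleProd_inv hA]
  exact rowCycleProd_congr (reverseCycle_pow_apply_of_sameCycle h) fun _ _ => rfl

lemma rowCycleProd_reverseCycle_of_not_sameCycle
    (A : Matrix (Fin n) (Fin n) SplitQuaternion)
    {σ : Equiv.Perm (Fin n)} {s t : Fin n} (h : ¬ σ.SameCycle s t) :
    rowCycleProd A (reverseCycle σ s) t = rowCycleProd A σ t :=
  rowCycleProd_congr (reverseCycle_pow_apply_of_not_sameCycle h) fun _ _ => rfl

lemma re_mul_comm (a b : SplitQuaternion) : (a * b).re = (b * a).re := by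
  simp; ring

lemma re_rowCycleProd_apply (A : Matrix (Fin n) (Fin n) SplitQuaternion)
    (σ : Equiv.Perm (Fin n)) (s : Fin n) :
    (rowCycleProd A σ (σ s)).re = (rowCycleProd A σ s).re := by
  have hp : Function.minimalPeriod σ (σ s) = Function.minimalPeriod σ s :=
    Function.minimalPeriod_apply (Function.Injective.mem_periodicPts σ.injective s)
  have hL := pow_minimalPeriod_apply σ s
  obtain ⟨L, hL'⟩ := Nat.exists_eq_succ_of_ne_zero (minimalPeriod_pos σ s).ne'
  have hs : ∀ m : ℕ, (σ ^ m) (σ s) = (σ ^ (m + 1)) s := fun m => by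
    rw [pow_succ, Equiv.Perm.mul_apply]
  simp only [rowCycleProd, hp, hs]
  rw [hL'] at hL ⊢
  rw [List.prod_range_succ, List.prod_range_succ', re_mul_comm]
  have h2 : (σ ^ (L.succ + 1)) s = (σ ^ (0 + 1)) s := by
    rw [pow_succ', Equiv.Perm.mul_apply, hL]; simp
  have h3 : (σ ^ (L + 1)) s = (σ ^ 0) s := by simpa using hL
  simp only [Nat.succ_eq_add_one] at *
  rw [h2, h3]

lemma re_rowCycleProd_of_sameCycle (A : Matrix (Fin n) (Fin n) SplitQuaternion)
    {σ : Equiv.Perm (Fin n)} {s t : Fin n} (h : σ.SameCycle s t) :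
    (rowCycleProd A σ t).re = (rowCycleProd A σ s).re := by
  obtain ⟨m, rfl⟩ := h.exists_nat_pow_eq
  induction m with
  | zero => rfl
  | succ m ih =>
    rw [pow_succ', Equiv.Perm.mul_apply, re_rowCycleProd_apply]
    exact ih (Equiv.Perm.sameCycle_pow_right.2 (.refl _ _))

/-! ### Replacing the trailing cycles by their real parts -/

lemma mem_otherCycleMins {σ : Equiv.Perm (Fin n)} {i s : Fin n} :
    s ∈ otherCycleMins σ i ↔ (∀ t, σ.SameCycle s t → s ≤ t) ∧ ¬ σ.SameCycle i s := by
  simp [otherCycleMins]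

lemma nodup_otherCycleMins (σ : Equiv.Perm (Fin n)) (i : Fin n) : (otherCycleMins σ i).Nodup :=
  Finset.sort_nodup _ _

lemma otherCycleMins_congr {σ τ : Equiv.Perm (Fin n)}
    (h : ∀ a b, σ.SameCycle a b ↔ τ.SameCycle a b) (i : Fin n) :
    otherCycleMins σ i = otherCycleMins τ i := by
  simp only [otherCycleMins, h]

lemma otherCycleMins_reverseCycle (σ : Equiv.Perm (Fin n)) (s i : Fin n) :
    otherCycleMins (reverseCycle σ s) i = otherCycleMins σ i :=
  otherCycleMins_congr (fun _ _ => sameCycle_reverseCycle) i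

/-- The product of the real parts of the cycle products of `A` over the cycles of `σ` not
containing `i`. -/
def otherCycleRe (A : Matrix (Fin n) (Fin n) SplitQuaternion) (σ : Equiv.Perm (Fin n))
    (i : Fin n) : ℝ :=
  ∏ s ∈ (otherCycleMins σ i).toFinset, (rowCycleProd A σ s).re

lemma sum_eq_sum_of_add_eq_add {α : Type*} [Fintype α] {R : α → α} (hR : Function.Involutive R)
    {F G : α → SplitQuaternion} (h : ∀ a, F a + F (R a) = G a + G (R a)) :
    ∑ a, F a = ∑ a, G a := by
  have hF : ∑ a, F (R a) = ∑ a, F a := Equiv.sum_comp hR.toPerm F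
  have hG : ∑ a, G (R a) = ∑ a, G a := Equiv.sum_comp hR.toPerm G
  have h2 : (2 : ℝ) • ∑ a, F a = (2 : ℝ) • ∑ a, G a := by
    rw [two_smul, two_smul]
    nth_rewrite 2 [← hF]
    nth_rewrite 2 [← hG]
    rw [← Finset.sum_add_distrib, ← Finset.sum_add_distrib]
    exact Finset.sum_congr rfl fun a _ => h a
  exact smul_right_injective _ two_ne_zero h2

lemma prod_map_add_prod_map {α R : Type*} [Ring R] {l : List α} (hl : l.Nodup) {a : α}
    (ha : a ∈ l) {f g p q : α → R}
    (hg : ∀ s ∈ l, s ≠ a → g s = f s) (hp : ∀ s ∈ l, s ≠ a → p s = f s)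
    (hq : ∀ s ∈ l, s ≠ a → q s = f s) (h : f a + g a = p a + q a) :
    (l.map f).prod + (l.map g).prod = (l.map p).prod + (l.map q).prod := by
  obtain ⟨l₁, l₂, rfl⟩ := List.append_of_mem ha
  rw [List.nodup_middle, List.nodup_cons, List.mem_append, not_or] at hl
  have hne : ∀ s, s ∈ l₁ ∨ s ∈ l₂ → s ∈ l₁ ++ a :: l₂ ∧ s ≠ a := by
    rintro s hs
    refine ⟨by simp; tauto, ?_⟩
    rintro rfl
    tauto
  have key : ∀ u : α → R, (∀ s ∈ l₁ ++ a :: l₂, s ≠ a → u s = f s) →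
      ((l₁ ++ a :: l₂).map u).prod = (l₁.map f).prod * (u a * (l₂.map f).prod) := by
    intro u hu
    rw [List.map_append, List.map_cons, List.prod_append, List.prod_cons,
      List.map_congr_left (l := l₁) (fun s hs => hu s (hne s (.inl hs)).1 (hne s (.inl hs)).2),
      List.map_congr_left (l := l₂) (fun s hs => hu s (hne s (.inr hs)).1 (hne s (.inr hs)).2)]
  rw [key f fun _ _ _ => rfl, key g hg, key p hp, key q hq, ← mul_add, ← mul_add, ← add_mul,
    ← add_mul, h]

lemma coe_otherCycleRe (A : Matrix (Fin n) (Fin n) SplitQuaternion) (σ : Equiv.Perm (Fin n))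
    (i : Fin n) : (otherCycleRe A σ i : SplitQuaternion) =
      ((otherCycleMins σ i).map fun s => ((rowCycleProd A σ s).re : SplitQuaternion)).prod := by
  rw [otherCycleRe, List.prod_toFinset _ (nodup_otherCycleMins σ i)]
  refine (map_list_prod (algebraMap ℝ SplitQuaternion) _).trans ?_
  rw [List.map_map]
  rfl

/-- Averaging over the reversals of the cycles not containing `i` replaces their cycle products
by real parts. -/
lemma sum_mul_prod_rowCycleProd {A : Matrix (Fin n) (Fin n) SplitQuaternion}
    (hA : A.IsHermitian) (i : Fin n) (u : Equiv.Perm (Fin n) → SplitQuaternion)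
    (hu : ∀ σ s, ¬ σ.SameCycle i s → u (reverseCycle σ s) = u σ) :
    ∑ σ : Equiv.Perm (Fin n), ((Equiv.Perm.sign σ : ℤ) : SplitQuaternion) *
        (u σ * ((otherCycleMins σ i).map (rowCycleProd A σ)).prod) =
      ∑ σ : Equiv.Perm (Fin n), ((Equiv.Perm.sign σ : ℤ) : SplitQuaternion) *
        (u σ * (otherCycleRe A σ i : SplitQuaternion)) := by
  let f : ℕ → Equiv.Perm (Fin n) → Fin n → SplitQuaternion := fun k σ s =>
    if (s : ℕ) < k then ((rowCycleProd A σ s).re : SplitQuaternion) else rowCycleProd A σ s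
  let F : ℕ → Equiv.Perm (Fin n) → SplitQuaternion := fun k σ =>
    ((Equiv.Perm.sign σ : ℤ) : SplitQuaternion) * (u σ * ((otherCycleMins σ i).map (f k σ)).prod)
  have step : ∀ k < n, ∑ σ, F k σ = ∑ σ, F (k + 1) σ := by
    intro k hk
    let κ : Fin n := ⟨k, hk⟩
    let R : Equiv.Perm (Fin n) → Equiv.Perm (Fin n) := fun σ =>
      if κ ∈ otherCycleMins σ i then reverseCycle σ κ else σ
    have hR : Function.Involutive R := by
      intro σ
      by_cases h : κ ∈ otherCycleMins σ i
      · simp [R, h, otherCycleMins_reverseCycle, reverseCycle_reverseCycle]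
      · simp [R, h]
    have hne : ∀ σ s, s ≠ κ → f (k + 1) σ s = f k σ s := by
      intro σ s hs
      have hs' : (s : ℕ) ≠ k := fun h => hs (Fin.ext h)
      simp only [f]
      congr 1
      exact propext ⟨fun h => by omega, fun h => by omega⟩
    refine sum_eq_sum_of_add_eq_add hR fun σ => ?_
    by_cases h : κ ∈ otherCycleMins σ i
    · have hmin := mem_otherCycleMins.1 h
      simp only [R, h, if_true, F, sign_reverseCycle, otherCycleMins_reverseCycle,
        hu σ κ hmin.2, ← mul_add]
      have hrev : ∀ s ∈ otherCycleMins σ i, s ≠ κ →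
          f k (reverseCycle σ κ) s = f k σ s := by
        intro s hs hsκ
        have hs' := mem_otherCycleMins.1 hs
        have : ¬ σ.SameCycle κ s := fun h' =>
          hsκ (le_antisymm (hs'.1 _ h'.symm) (hmin.1 _ h'))
        simp only [f, rowCycleProd_reverseCycle_of_not_sameCycle A this]
      congr 2
      refine prod_map_add_prod_map (nodup_otherCycleMins σ i) h hrev
        (fun s _ hs => hne σ s hs) (fun s hs hsκ => (hne _ s hsκ).trans (hrev s hs hsκ)) ?_
      have hκ : (κ : ℕ) = k := rfl
      simp only [f, hκ, lt_irrefl, if_false, Nat.lt_succ_self, if_true,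
        rowCycleProd_reverseCycle_of_sameCycle hA (Equiv.Perm.SameCycle.refl σ κ)]
      ext <;> simp
    · have hF : F k σ = F (k + 1) σ := by
        simp only [F]
        rw [List.map_congr_left fun s hs => (hne σ s fun h' => h (h' ▸ hs)).symm]
      simp only [R, h, if_false, hF]
  have all : ∀ k ≤ n, ∑ σ, F 0 σ = ∑ σ, F k σ := by
    intro k hk
    induction k with
    | zero => rfl
    | succ k ih => rw [ih (by omega), step k hk]
  calc _ = ∑ σ, F 0 σ := by simp [F, f]
    _ = ∑ σ, F n σ := all n le_rfl
    _ = _ := by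
      refine Finset.sum_congr rfl fun σ _ => ?_
      rw [coe_otherCycleRe]
      simp only [F, f, Fin.is_lt, if_true]

lemma rdet_updateRow {A : Matrix (Fin n) (Fin n) SplitQuaternion} (hA : A.IsHermitian)
    (i : Fin n) (b : Fin n → SplitQuaternion) :
    rdet (A.updateRow i b) i =
      ∑ σ : Equiv.Perm (Fin n), ((Equiv.Perm.sign σ : ℤ) : SplitQuaternion) *
        (rowCycleProd (A.updateRow i b) σ i * (otherCycleRe A σ i : SplitQuaternion)) := by
  rw [← sum_mul_prod_rowCycleProd hA i fun σ => rowCycleProd (A.updateRow i b) σ i]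
  · rw [rdet]
    refine Finset.sum_congr rfl fun σ _ => ?_
    congr 3
    refine List.map_congr_left fun s hs => ?_
    refine rowCycleProd_congr (fun _ => rfl) fun t ht => ?_
    have hs' := (mem_otherCycleMins.1 hs).2
    exact Matrix.updateRow_ne fun h => hs' (h ▸ ht.symm)
  · intro σ s hs
    exact rowCycleProd_reverseCycle_of_not_sameCycle _ fun h => hs h.symm

lemma cdet_updateRow {A : Matrix (Fin n) (Fin n) SplitQuaternion} (hA : A.IsHermitian)
    (i : Fin n) (b : Fin n → SplitQuaternion) :
    cdet (A.updateRow i b) i = rdet (A.updateRow i b) i := by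
  have hstar : star (cdet (A.updateRow i b) i) =
      ∑ σ : Equiv.Perm (Fin n), ((Equiv.Perm.sign σ : ℤ) : SplitQuaternion) *
        (star (colCycleProd (A.updateRow i b) σ i) *
          (otherCycleRe A σ i : SplitQuaternion)) := by
    rw [← sum_mul_prod_rowCycleProd hA i fun σ => star (colCycleProd (A.updateRow i b) σ i)]
    · rw [cdet, star_sum]
      refine Finset.sum_congr rfl fun σ _ => ?_
      rw [star_mul, star_intCast, ← Int.cast_comm, star_mul, List.map_reverse, star_prod_reverse,
        List.map_map]
      congr 3
      refine List.map_congr_left fun s hs => ?_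
      rw [Function.comp_apply, ← star_colCycleProd hA]
      congr 1
      refine colCycleProd_congr (fun _ => rfl) fun t ht => ?_
      have hs' := (mem_otherCycleMins.1 hs).2
      exact Matrix.updateRow_ne fun h => hs' (h ▸ ht.symm)
    · intro σ s hs
      congr 1
      exact colCycleProd_congr
        (reverseCycle_pow_apply_of_not_sameCycle fun h => hs h.symm) fun _ _ => rfl
  have hinv : ∀ σ : Equiv.Perm (Fin n), otherCycleRe A σ⁻¹ i = otherCycleRe A σ i := by
    intro σ
    rw [otherCycleRe, otherCycleRe,
      otherCycleMins_congr (σ := σ⁻¹) fun _ _ => Equiv.Perm.sameCycle_inv]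
    refine Finset.prod_congr rfl fun s _ => ?_
    rw [rowCycleProd_inv hA]
    simp
  rw [← star_star (cdet _ _), hstar, rdet_updateRow hA, star_sum,
    ← Equiv.sum_comp (Equiv.inv (Equiv.Perm (Fin n)))]
  refine Finset.sum_congr rfl fun σ _ => ?_
  rw [star_mul, star_intCast, ← Int.cast_comm, star_mul, star_star, Equiv.inv_apply,
    colCycleProd_inv, hinv, QuaternionAlgebra.star_coe, QuaternionAlgebra.coe_commutes,
    Equiv.Perm.sign_inv]

/-! ### Left linearity in the replaced row -/

lemma exists_rowCycleProd_updateRow_eq_mul (A : Matrix (Fin n) (Fin n) SplitQuaternion)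
    (σ : Equiv.Perm (Fin n)) (i : Fin n) :
    ∃ Z : SplitQuaternion, ∀ b : Fin n → SplitQuaternion,
      rowCycleProd (A.updateRow i b) σ i = b (σ i) * Z := by
  obtain ⟨L, hL⟩ := Nat.exists_eq_succ_of_ne_zero (minimalPeriod_pos σ i).ne'
  refine ⟨((List.range L).map fun m => A ((σ ^ (m + 1)) i) ((σ ^ (m + 1 + 1)) i)).prod,
    fun b => ?_⟩
  rw [rowCycleProd, hL, List.prod_range_succ']
  congr 1
  · simp
  · congr 1
    refine List.map_congr_left fun m hm => ?_
    rw [Matrix.updateRow_ne]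
    intro h
    rw [← Equiv.Perm.iterate_eq_pow] at h
    refine Function.not_isPeriodicPt_of_pos_of_lt_minimalPeriod m.succ_ne_zero ?_ h
    have := List.mem_range.1 hm
    omega

lemma rdet_updateRow_sum_mul {A : Matrix (Fin n) (Fin n) SplitQuaternion} (hA : A.IsHermitian)
    (i : Fin n) {k : ℕ} (c : Fin k → SplitQuaternion) (b : Fin k → Fin n → SplitQuaternion) :
    rdet (A.updateRow i fun q => ∑ l, c l * b l q) i =
      ∑ l, c l * rdet (A.updateRow i (b l)) i := by
  simp only [rdet_updateRow hA, Finset.mul_sum]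
  rw [Finset.sum_comm]
  refine Finset.sum_congr rfl fun σ _ => ?_
  obtain ⟨Z, hZ⟩ := exists_rowCycleProd_updateRow_eq_mul A σ i
  simp only [hZ, Finset.sum_mul, Finset.mul_sum]
  refine Finset.sum_congr rfl fun l _ => ?_
  rw [← mul_assoc (c l), ← Int.cast_comm]
  simp only [mul_assoc]

/-! ### Merging two cycles by a transposition -/

section Merge

variable {σ : Equiv.Perm (Fin n)} {i j : Fin n}

lemma mul_swap_apply_of_not_sameCycle {t : Fin n} (hi : ¬ σ.SameCycle i t)
    (hj : ¬ σ.SameCycle j t) : (σ * Equiv.swap i j) t = σ t := by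
  rw [Equiv.Perm.mul_apply, Equiv.swap_apply_of_ne_of_ne]
  · rintro rfl
    exact hi (.refl _ _)
  · rintro rfl
    exact hj (.refl _ _)

lemma mul_swap_pow_apply_of_not_sameCycle {t : Fin n} (hi : ¬ σ.SameCycle i t)
    (hj : ¬ σ.SameCycle j t) (m : ℕ) : ((σ * Equiv.swap i j) ^ m) t = (σ ^ m) t := by
  induction m with
  | zero => rfl
  | succ m ih =>
    rw [pow_succ', pow_succ' σ, Equiv.Perm.mul_apply, ih, mul_swap_apply_of_not_sameCycle,
      Equiv.Perm.mul_apply]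
    · exact fun h => hi (Equiv.Perm.sameCycle_pow_right.1 h)
    · exact fun h => hj (Equiv.Perm.sameCycle_pow_right.1 h)

lemma pow_apply_ne_self {s : Fin n} {m : ℕ} (hm : m ≠ 0)
    (hlt : m < Function.minimalPeriod σ s) : (σ ^ m) s ≠ s := by
  rw [← Equiv.Perm.iterate_eq_pow]
  exact Function.not_isPeriodicPt_of_pos_of_lt_minimalPeriod hm hlt

lemma pow_apply_ne_of_not_sameCycle (hij : ¬ σ.SameCycle i j) (m : ℕ) : (σ ^ m) j ≠ i :=
  fun h => hij (Equiv.Perm.SameCycle.symm ⟨m, by simpa using h⟩)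

lemma mul_swap_pow_succ_apply_left (hij : ¬ σ.SameCycle i j) {m : ℕ}
    (hm : m < Function.minimalPeriod σ j) :
    ((σ * Equiv.swap i j) ^ (m + 1)) i = (σ ^ (m + 1)) j := by
  induction m with
  | zero => simp
  | succ m ih =>
    rw [pow_succ', pow_succ' σ (m + 1), Equiv.Perm.mul_apply, ih (by omega),
      Equiv.Perm.mul_apply, Equiv.Perm.mul_apply, Equiv.swap_apply_of_ne_of_ne]
    · exact pow_apply_ne_of_not_sameCycle hij _
    · exact pow_apply_ne_self m.succ_ne_zero hm

lemma mul_swap_pow_succ_apply_right (hij : ¬ σ.SameCycle i j) {m : ℕ}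
    (hm : m < Function.minimalPeriod σ i) :
    ((σ * Equiv.swap i j) ^ (m + 1)) j = (σ ^ (m + 1)) i := by
  rw [Equiv.swap_comm]
  exact mul_swap_pow_succ_apply_left (fun h => hij h.symm) hm

lemma mul_swap_pow_minimalPeriod_apply (hij : ¬ σ.SameCycle i j) :
    ((σ * Equiv.swap i j) ^ Function.minimalPeriod σ j) i = j := by
  obtain ⟨L, hL⟩ := Nat.exists_eq_succ_of_ne_zero (minimalPeriod_pos σ j).ne'
  have h := mul_swap_pow_succ_apply_left hij (m := L) (by omega)
  rwa [← Nat.succ_eq_add_one, ← hL, pow_minimalPeriod_apply] at h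

lemma mul_swap_pow_add_apply (hij : ¬ σ.SameCycle i j) (m : ℕ) :
    ((σ * Equiv.swap i j) ^ (Function.minimalPeriod σ j + m)) i =
      ((σ * Equiv.swap i j) ^ m) j := by
  rw [add_comm, pow_add, Equiv.Perm.mul_apply, mul_swap_pow_minimalPeriod_apply hij]

lemma sameCycle_mul_swap_self (hij : ¬ σ.SameCycle i j) :
    (σ * Equiv.swap i j).SameCycle i j :=
  ⟨Function.minimalPeriod σ j, by simpa using mul_swap_pow_minimalPeriod_apply hij⟩

lemma minimalPeriod_mul_swap (hij : ¬ σ.SameCycle i j) :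
    Function.minimalPeriod (σ * Equiv.swap i j) i =
      Function.minimalPeriod σ j + Function.minimalPeriod σ i := by
  have hji : ¬ σ.SameCycle j i := fun h => hij h.symm
  apply le_antisymm
  · refine Function.IsPeriodicPt.minimalPeriod_le (Nat.add_pos_left (minimalPeriod_pos σ j) _) ?_
    rw [Function.IsPeriodicPt, Function.IsFixedPt, Equiv.Perm.iterate_eq_pow,
      mul_swap_pow_add_apply hij, Equiv.swap_comm]
    exact mul_swap_pow_minimalPeriod_apply hji
  · by_contra! hlt
    have hper := pow_minimalPeriod_apply (σ * Equiv.swap i j) i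
    have hpos := minimalPeriod_pos (σ * Equiv.swap i j) i
    generalize Function.minimalPeriod (σ * Equiv.swap i j) i = p at hlt hper hpos
    rcases le_or_gt p (Function.minimalPeriod σ j) with hp | hp
    · obtain ⟨m, rfl⟩ := Nat.exists_eq_succ_of_ne_zero hpos.ne'
      rw [Nat.succ_eq_add_one, mul_swap_pow_succ_apply_left hij (by omega)] at hper
      exact pow_apply_ne_of_not_sameCycle hij _ hper
    · obtain ⟨m, rfl⟩ := Nat.exists_eq_add_of_lt hp
      rw [add_assoc, mul_swap_pow_add_apply hij,
        mul_swap_pow_succ_apply_right hij (by omega)] at hper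
      exact pow_apply_ne_self m.succ_ne_zero (by omega) hper

lemma not_sameCycle_mul_swap (hne : i ≠ j) (hij : σ.SameCycle i j) :
    ¬ (σ * Equiv.swap i j).SameCycle i j := by
  have hex : ∃ m, (σ ^ m) i = j := hij.exists_nat_pow_eq
  obtain ⟨L, hL, hmin⟩ : ∃ L, (σ ^ L) i = j ∧ ∀ m < L, (σ ^ m) i ≠ j :=
    ⟨Nat.find hex, Nat.find_spec hex, fun m hm => Nat.find_min hex hm⟩
  have hL0 : L ≠ 0 := by
    rintro rfl
    exact hne hL
  have hi : ∀ m, m ≠ 0 → m ≤ L → (σ ^ m) i ≠ i := by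
    intro m hm hmL h
    refine hmin (L - m) (by omega) ?_
    rw [← h, ← Equiv.Perm.mul_apply, ← pow_add, Nat.sub_add_cancel hmL, hL]
  have hpow : ∀ m < L, ((σ * Equiv.swap i j) ^ (m + 1)) j = (σ ^ (m + 1)) i := by
    intro m hm
    induction m with
    | zero => simp
    | succ m ih =>
      rw [pow_succ', pow_succ' σ (m + 1), Equiv.Perm.mul_apply, ih (by omega),
        Equiv.Perm.mul_apply, Equiv.Perm.mul_apply, Equiv.swap_apply_of_ne_of_ne]
      · exact hi _ m.succ_ne_zero hm.le
      · exact hmin _ hm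
  have hper : Function.IsPeriodicPt (σ * Equiv.swap i j) L j := by
    obtain ⟨m, rfl⟩ := Nat.exists_eq_succ_of_ne_zero hL0
    rw [Function.IsPeriodicPt, Function.IsFixedPt, Equiv.Perm.iterate_eq_pow]
    exact (hpow m (by omega)).trans hL
  intro h
  obtain ⟨r, hr⟩ := h.symm.exists_nat_pow_eq
  rw [← Equiv.Perm.iterate_eq_pow, ← hper.iterate_mod_apply, Equiv.Perm.iterate_eq_pow] at hr
  have hlt : r % L < L := Nat.mod_lt _ (Nat.pos_of_ne_zero hL0)
  generalize r % L = m at hr hlt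
  cases m with
  | zero => exact hne hr.symm
  | succ m =>
    rw [hpow m (by omega)] at hr
    exact hi _ m.succ_ne_zero hlt.le hr

lemma SameCycle.mul_swap (hij : ¬ σ.SameCycle i j) {a b : Fin n} (h : σ.SameCycle a b) :
    (σ * Equiv.swap i j).SameCycle a b := by
  have hs := sameCycle_mul_swap_self hij
  have hstep : ∀ x, (σ * Equiv.swap i j).SameCycle x (σ x) := by
    intro x
    have hx : σ x = (σ * Equiv.swap i j) (Equiv.swap i j x) := by simp
    rw [hx, Equiv.Perm.sameCycle_apply_right]
    rcases eq_or_ne x i with rfl | hxi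
    · rwa [Equiv.swap_apply_left]
    rcases eq_or_ne x j with rfl | hxj
    · rw [Equiv.swap_apply_right]
      exact hs.symm
    · rw [Equiv.swap_apply_of_ne_of_ne hxi hxj]
  obtain ⟨m, rfl⟩ := h.exists_nat_pow_eq
  clear h
  induction m with
  | zero => exact .refl _ _
  | succ m ih =>
    rw [pow_succ', Equiv.Perm.mul_apply]
    exact ih.trans (hstep _)

lemma sameCycle_mul_swap_iff_of_not_sameCycle {t u : Fin n} (hi : ¬ σ.SameCycle i t)
    (hj : ¬ σ.SameCycle j t) : (σ * Equiv.swap i j).SameCycle t u ↔ σ.SameCycle t u := by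
  constructor <;> intro h
  · obtain ⟨m, rfl⟩ := h.exists_nat_pow_eq
    rw [mul_swap_pow_apply_of_not_sameCycle hi hj]
    exact Equiv.Perm.sameCycle_pow_right.2 (.refl _ _)
  · obtain ⟨m, rfl⟩ := h.exists_nat_pow_eq
    rw [← mul_swap_pow_apply_of_not_sameCycle hi hj]
    exact Equiv.Perm.sameCycle_pow_right.2 (.refl _ _)

lemma sameCycle_mul_swap_left_iff (hij : ¬ σ.SameCycle i j) {t : Fin n} :
    (σ * Equiv.swap i j).SameCycle i t ↔ σ.SameCycle i t ∨ σ.SameCycle j t := by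
  constructor
  · intro h
    by_contra! hn
    exact hn.1 ((sameCycle_mul_swap_iff_of_not_sameCycle hn.1 hn.2).1 h.symm).symm
  · rintro (h | h)
    · exact SameCycle.mul_swap hij h
    · exact (sameCycle_mul_swap_self hij).trans (SameCycle.mul_swap hij h)

lemma rowCycleProd_mul_swap (A : Matrix (Fin n) (Fin n) SplitQuaternion)
    (hij : ¬ σ.SameCycle i j) :
    rowCycleProd (A.updateRow i (A j)) (σ * Equiv.swap i j) i =
      rowCycleProd A σ j * rowCycleProd (A.updateRow i (A j)) σ i := by
  have hne : j ≠ i := pow_apply_ne_of_not_sameCycle hij 0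
  simp only [rowCycleProd]
  rw [minimalPeriod_mul_swap hij, List.range_add, List.map_append, List.prod_append, List.map_map]
  congr 2
  · refine List.map_congr_left fun m hm => ?_
    rw [mul_swap_pow_succ_apply_left hij (List.mem_range.1 hm)]
    cases m with
    | zero => simp
    | succ m =>
      rw [mul_swap_pow_succ_apply_left hij (by have := List.mem_range.1 hm; omega),
        Matrix.updateRow_ne (pow_apply_ne_of_not_sameCycle hij _)]
  · refine List.map_congr_left fun m hm => ?_
    rw [Function.comp_apply, add_assoc, mul_swap_pow_add_apply hij, mul_swap_pow_add_apply hij,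
      mul_swap_pow_succ_apply_right hij (List.mem_range.1 hm)]
    cases m with
    | zero => simp [Matrix.updateRow_ne hne]
    | succ m =>
      rw [mul_swap_pow_succ_apply_right hij (by have := List.mem_range.1 hm; omega)]

/-- The product of the real parts of the cycle products of `A` over the cycles of `σ` containing
neither `i` nor `j`. -/
def otherCycleRe₂ (A : Matrix (Fin n) (Fin n) SplitQuaternion) (σ : Equiv.Perm (Fin n))
    (i j : Fin n) : ℝ :=
  ∏ s ∈ (otherCycleMins σ i).toFinset with ¬ σ.SameCycle j s, (rowCycleProd A σ s).re

lemma otherCycleRe₂_reverseCycle (A : Matrix (Fin n) (Fin n) SplitQuaternion)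
    (σ : Equiv.Perm (Fin n)) (i j : Fin n) :
    otherCycleRe₂ A (reverseCycle σ j) i j = otherCycleRe₂ A σ i j := by
  simp only [otherCycleRe₂, otherCycleMins_reverseCycle, sameCycle_reverseCycle]
  refine Finset.prod_congr rfl fun s hs => ?_
  rw [rowCycleProd_reverseCycle_of_not_sameCycle A (Finset.mem_filter.1 hs).2]

lemma otherCycleRe_mul_swap (A : Matrix (Fin n) (Fin n) SplitQuaternion)
    (hij : ¬ σ.SameCycle i j) :
    otherCycleRe A (σ * Equiv.swap i j) i = otherCycleRe₂ A σ i j := by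
  rw [otherCycleRe, otherCycleRe₂]
  refine Finset.prod_congr ?_ fun s hs => ?_
  · ext s
    rw [Finset.mem_filter, List.mem_toFinset, List.mem_toFinset, mem_otherCycleMins,
      mem_otherCycleMins, sameCycle_mul_swap_left_iff hij, not_or, and_assoc]
    refine and_congr_left fun hs => forall_congr' fun t => ?_
    rw [sameCycle_mul_swap_iff_of_not_sameCycle hs.1 hs.2]
  · rw [Finset.mem_filter, List.mem_toFinset, mem_otherCycleMins] at hs
    rw [rowCycleProd_congr (mul_swap_pow_apply_of_not_sameCycle hs.1.2 hs.2) fun _ _ => rfl]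

lemma otherCycleRe_eq_mul (A : Matrix (Fin n) (Fin n) SplitQuaternion)
    (hij : ¬ σ.SameCycle i j) :
    otherCycleRe A σ i = (rowCycleProd A σ j).re * otherCycleRe₂ A σ i j := by
  obtain ⟨κ, hκ, hmin⟩ := Finset.exists_min_image
    (Finset.univ.filter fun t => σ.SameCycle j t) id ⟨j, by simp [Equiv.Perm.SameCycle.refl]⟩
  simp only [Finset.mem_filter, Finset.mem_univ, true_and, id] at hκ hmin
  have hκs : κ ∉ (otherCycleMins σ i).toFinset.filter fun s => ¬ σ.SameCycle j s := by simp [hκ]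
  rw [otherCycleRe, otherCycleRe₂, ← re_rowCycleProd_of_sameCycle A hκ,
    ← Finset.prod_insert (f := fun s => (rowCycleProd A σ s).re) hκs]
  refine Finset.prod_congr ?_ fun _ _ => rfl
  ext s
  rw [Finset.mem_insert, Finset.mem_filter, List.mem_toFinset, mem_otherCycleMins]
  constructor
  · intro hs
    by_cases hjs : σ.SameCycle j s
    · exact .inl (le_antisymm (hs.1 _ (hjs.symm.trans hκ)) (hmin _ hjs))
    · exact .inr ⟨hs, hjs⟩
  · rintro (rfl | hs)
    · exact ⟨fun t ht => hmin _ (hκ.trans ht), fun h => hij (h.trans hκ.symm)⟩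
    · exact hs.1

end Merge

lemma rdet_updateRow_of_ne {A : Matrix (Fin n) (Fin n) SplitQuaternion} (hA : A.IsHermitian)
    {i j : Fin n} (hne : i ≠ j) : rdet (A.updateRow i (A j)) i = 0 := by
  have hsum (g : Equiv.Perm (Fin n) → SplitQuaternion) :
      ∑ σ with ¬¬ σ.SameCycle i j, g σ = ∑ σ with ¬ σ.SameCycle i j, g (σ * Equiv.swap i j) := by
    refine Finset.sum_nbij' (fun σ => σ * Equiv.swap i j) (fun σ => σ * Equiv.swap i j)
      ?_ ?_ (by simp [mul_assoc]) (by simp [mul_assoc]) (by simp [mul_assoc])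
    · intro σ hσ
      simp only [Finset.mem_filter, Finset.mem_univ, true_and, not_not] at hσ ⊢
      exact not_sameCycle_mul_swap hne hσ
    · intro σ hσ
      simp only [Finset.mem_filter, Finset.mem_univ, true_and, not_not] at hσ ⊢
      exact sameCycle_mul_swap_self hσ
  rw [rdet_updateRow hA,
    ← Finset.sum_filter_add_sum_filter_not Finset.univ fun σ => ¬ σ.SameCycle i j, hsum,
    ← Finset.sum_add_distrib, Finset.sum_filter]
  refine (sum_eq_sum_of_add_eq_add (G := fun _ => 0) (R := fun σ => reverseCycle σ j)
    (fun σ => reverseCycle_reverseCycle σ j) fun σ => ?_).trans Finset.sum_const_zero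
  simp only [sameCycle_reverseCycle]
  by_cases hij : σ.SameCycle i j
  · simp [hij]
  have hij' : ¬ (reverseCycle σ j).SameCycle i j := fun h => hij (sameCycle_reverseCycle.1 h)
  simp only [hij, not_false_iff, if_true, otherCycleRe_mul_swap A hij,
    otherCycleRe_mul_swap A hij', otherCycleRe_eq_mul A hij, otherCycleRe_eq_mul A hij',
    rowCycleProd_mul_swap A hij, rowCycleProd_mul_swap A hij', otherCycleRe₂_reverseCycle,
    rowCycleProd_reverseCycle_of_sameCycle hA (Equiv.Perm.SameCycle.refl σ j),
    rowCycleProd_reverseCycle_of_not_sameCycle (A.updateRow i (A j)) fun h => hij h.symm,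
    Equiv.Perm.sign_mul, sign_reverseCycle, Equiv.Perm.sign_swap hne]
  generalize rowCycleProd A σ j = X
  generalize rowCycleProd (A.updateRow i (A j)) σ i = Y
  have hre : (star X).re = X.re := by simp
  have hX : star X = (X.re : SplitQuaternion) + (X.re : SplitQuaternion) - X := by
    ext <;> simp
  rw [hre, hX]
  simp only [← QuaternionAlgebra.coe_commutes, QuaternionAlgebra.coe_mul_eq_smul, sub_mul,
    add_mul, Units.val_neg, mul_neg, mul_one, Int.cast_neg, neg_mul, mul_sub, mul_add,
    mul_smul_comm, smul_smul]
  module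

/-- If the `i`-th row of a Hermitian matrix `A` is replaced with a left linear
combination of its other rows, then the `i`-th row determinant and the `i`-th
column determinant of the resulting matrix vanish. -/
theorem rdet_cdet_updateRow_linear_combination_eq_zero
    (A : Matrix (Fin n) (Fin n) SplitQuaternion) (hA : A.IsHermitian) (i : Fin n)
    (k : ℕ) (c : Fin k → SplitQuaternion) (idx : Fin k → Fin n)
    (hidx : ∀ l, idx l ≠ i) :
    rdet (A.updateRow i (fun q => ∑ l : Fin k, c l * A (idx l) q)) i = 0 ∧
    cdet (A.updateRow i (fun q => ∑ l : Fin k, c l * A (idx l) q)) i = 0 := by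
  have hrdet : rdet (A.updateRow i (fun q => ∑ l : Fin k, c l * A (idx l) q)) i = 0 := by
    rw [rdet_updateRow_sum_mul hA]
    refine Finset.sum_eq_zero fun l _ => ?_
    rw [rdet_updateRow_of_ne hA (hidx l).symm, mul_zero]
  exact ⟨hrdet, (cdet_updateRow hA i _).trans hrdet⟩

end SplitQuaternion

end
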